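/- There do not exist four distinct rank-one orthogonal projections P, Q, R, S on ℂ² such that tr(XY) = 3 − 2√2 for every pair of distinct elements X, Y of {P,Q,R,S}; that is, no four distinct one-dimensional subspaces of ℂ² pairwise make the angle cos⁻¹(√2 − 1) with one another (note (√2 − 1)² = 3 − 2√2 ≠ 1/3). -/

import Mathlib

open Matrix

open scoped ComplexOrder in
/-- If three rank-one orthogonal projections on ℂ² satisfy `tr(XY) = t` for each pair,
then `t ≥ 1/4`. -/
theorem one_fourth_le_of_three_projections {P Q R : Matrix (Fin 2) (Fin 2) ℂ} {t : ℝ}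
    (hP : Pᴴ = P ∧ P * P = P ∧ P.trace = 1)
    (hQ : Qᴴ = Q ∧ Q * Q = Q ∧ Q.trace = 1)
    (hR : Rᴴ = R ∧ R * R = R ∧ R.trace = 1)
    (hPQ : (P * Q).trace = (t : ℂ)) (hPR : (P * R).trace = (t : ℂ))
    (hQR : (Q * R).trace = (t : ℂ)) : 1 / 4 ≤ t := by
  obtain ⟨hP₁, hP₂, hP₃⟩ := hP
  obtain ⟨hQ₁, hQ₂, hQ₃⟩ := hQ
  obtain ⟨hR₁, hR₂, hR₃⟩ := hR
  set A := P + Q + R with hA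
  set M := A + A - (1 + 1 + 1) with hM
  have hM_herm : Mᴴ = M := by
    simp [hM, hA, hP₁, hQ₁, hR₁]
  have hAA : (A * A).trace = 3 + 6 * (t : ℂ) := by
    simp only [hA, add_mul, mul_add, trace_add, hP₂, hQ₂, hR₂, hP₃, hQ₃, hR₃, hPQ, hPR, hQR,
      trace_mul_comm Q P, trace_mul_comm R P, trace_mul_comm R Q]
    ring
  have hA_trace : A.trace = 3 := by
    simp only [hA, trace_add, hP₃, hQ₃, hR₃]
    norm_num
  have hMM : (Mᴴ * M).trace = ((24 * t - 6 : ℝ) : ℂ) := by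
    rw [hM_herm, hM]
    simp only [sub_mul, mul_sub, add_mul, mul_add, one_mul, mul_one, trace_add, trace_sub,
      hAA, hA_trace, trace_one, Fintype.card_fin]
    push_cast
    ring
  have h_nonneg : (0 : ℂ) ≤ (Mᴴ * M).trace := (posSemidef_conjTranspose_mul_self M).trace_nonneg
  rw [hMM, Complex.zero_le_real] at h_nonneg
  linarith

/-- There do not exist four distinct rank-one orthogonal projections on ℂ²
with tr(XY) = 3 − 2√2 for every distinct pair X, Y, i.e. no four distinct
lines in ℂ² pairwise make the angle cos⁻¹(√2 − 1). -/
theorem no_four_projections_at_angle_sqrt_two_sub_one :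
    ¬ ∃ P Q R S : Matrix (Fin 2) (Fin 2) ℂ,
      (Pᴴ = P ∧ P * P = P ∧ P.trace = 1) ∧
      (Qᴴ = Q ∧ Q * Q = Q ∧ Q.trace = 1) ∧
      (Rᴴ = R ∧ R * R = R ∧ R.trace = 1) ∧
      (Sᴴ = S ∧ S * S = S ∧ S.trace = 1) ∧
      (P ≠ Q ∧ P ≠ R ∧ P ≠ S ∧ Q ≠ R ∧ Q ≠ S ∧ R ≠ S) ∧
      (∀ X ∈ ({P, Q, R, S} : Set (Matrix (Fin 2) (Fin 2) ℂ)),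
        ∀ Y ∈ ({P, Q, R, S} : Set (Matrix (Fin 2) (Fin 2) ℂ)),
          X ≠ Y → (X * Y).trace = ((3 - 2 * Real.sqrt 2 : ℝ) : ℂ)) := by
  rintro ⟨P, Q, R, S, hP, hQ, hR, -, ⟨hPQ, hPR, -, hQR, -, -⟩, h⟩
  have h_le := one_fourth_le_of_three_projections hP hQ hR
    (h P (by simp) Q (by simp) hPQ) (h P (by simp) R (by simp) hPR)
    (h Q (by simp) R (by simp) hQR)
  have h_sqrt : (1.4 : ℝ) < Real.sqrt 2 := Real.lt_sqrt_of_sq_lt (by norm_num)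
  linarith
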